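/- Let T be a bounded linear operator on a complex Hilbert space H with T*T ≥ I (T is expansive), and suppose that ‖Σ_{j=0}^{n} T^{*j}T^{j}‖ = O(n) as n → ∞. Then T is similar to an isometry. -/

import Mathlib

open ContinuousLinearMap

section

open Filter Topology

variable {H : Type*} [NormedAddCommGroup H] [InnerProductSpace ℂ H]

/-- If the squared norms `‖S n x‖ ^ 2` converge for every `x`, then so do the inner products
`⟪S n x, S n y⟫`. -/
lemma exists_tendsto_inner_of_tendsto_norm_sq (S : ℕ → H →L[ℂ] H)
    (hS : ∀ x, ∃ l : ℝ, Tendsto (fun n ↦ ‖S n x‖ ^ 2) atTop (𝓝 l)) (x y : H) :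
    ∃ l : ℂ, Tendsto (fun n ↦ inner ℂ (S n x) (S n y)) atTop (𝓝 l) := by
  have hS' : ∀ z, ∃ l : ℂ, Tendsto (fun n ↦ (‖S n z‖ : ℂ) ^ 2) atTop (𝓝 l) := fun z ↦ by
    obtain ⟨l, hl⟩ := hS z
    exact ⟨l, by exact_mod_cast (Complex.continuous_ofReal.tendsto l).comp hl⟩
  obtain ⟨a, ha⟩ := hS' (x + y)
  obtain ⟨b, hb⟩ := hS' (x - y)
  obtain ⟨c, hc⟩ := hS' (x - Complex.I • y)
  obtain ⟨d, hd⟩ := hS' (x + Complex.I • y)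
  refine ⟨(a - b + (c - d) * Complex.I) / 4, ?_⟩
  refine (((ha.sub hb).add ((hc.sub hd).mul_const Complex.I)).div_const 4).congr fun n ↦ ?_
  simp [inner_eq_sum_norm_sq_div_four (𝕜 := ℂ) (S n x) (S n y)]

/-- A uniformly bounded sequence of operators whose norms converge pointwise has a limit Gram
operator. -/
lemma exists_tendsto_inner_clm [CompleteSpace H] (S : ℕ → H →L[ℂ] H) (M : ℝ)
    (hM : ∀ n x, ‖S n x‖ ≤ M * ‖x‖)
    (hS : ∀ x, ∃ l : ℝ, Tendsto (fun n ↦ ‖S n x‖ ^ 2) atTop (𝓝 l)) :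
    ∃ P : H →L[ℂ] H, ∀ x y,
      Tendsto (fun n ↦ inner ℂ (S n x) (S n y)) atTop (𝓝 (inner ℂ (P x) y)) := by
  choose f hf using exists_tendsto_inner_of_tendsto_norm_sq S hS
  let B : H →ₗ⋆[ℂ] H →ₗ[ℂ] ℂ := LinearMap.mk₂'ₛₗ (starRingEnd ℂ) (RingHom.id ℂ) f
    (fun x x' y ↦ tendsto_nhds_unique (hf _ _) <| ((hf x y).add (hf x' y)).congr fun n ↦ by simp)
    (fun c x y ↦ tendsto_nhds_unique (hf _ _) <| ((hf x y).const_smul _).congr fun n ↦ by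
      simp [mul_comm])
    (fun x y y' ↦ tendsto_nhds_unique (hf _ _) <| ((hf x y).add (hf x y')).congr fun n ↦ by simp)
    (fun c x y ↦ tendsto_nhds_unique (hf _ _) <| ((hf x y).const_smul _).congr fun n ↦ by simp)
  have hB : ∀ x y, ‖B x y‖ ≤ M ^ 2 * ‖x‖ * ‖y‖ := fun x y ↦
    le_of_tendsto (hf x y).norm <| Eventually.of_forall fun n ↦ calc
      ‖inner ℂ (S n x) (S n y)‖ ≤ ‖S n x‖ * ‖S n y‖ := norm_inner_le_norm _ _
      _ ≤ (M * ‖x‖) * (M * ‖y‖) :=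
        mul_le_mul (hM n x) (hM n y) (norm_nonneg _) ((norm_nonneg _).trans (hM n x))
      _ = M ^ 2 * ‖x‖ * ‖y‖ := by ring
  refine ⟨InnerProductSpace.continuousLinearMapOfBilin (B.mkContinuous₂ (M ^ 2) hB), fun x y ↦ ?_⟩
  rw [InnerProductSpace.continuousLinearMapOfBilin_apply]
  exact hf x y

/-- An operator bounded below by the identity in the Loewner order has the form `L† L` with `L`
invertible. -/
lemma exists_equiv_norm_sq_eq_re_inner [CompleteSpace H] (P : H →L[ℂ] H) (hP : 1 ≤ P) :
    ∃ L : H ≃L[ℂ] H, ∀ x, ‖L x‖ ^ 2 = (inner ℂ (P x) x).re := by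
  have hP0 : 0 ≤ P := zero_le_one.trans hP
  have hU : IsUnit (CFC.sqrt P) := (CFC.isUnit_sqrt_iff P hP0).2 <|
    CStarAlgebra.isUnit_of_le 1 hP
  obtain ⟨u, hu⟩ := hU
  refine ⟨ContinuousLinearEquiv.ofUnit u, fun x ↦ ?_⟩
  have hsa : (CFC.sqrt P).IsPositive :=
    (ContinuousLinearMap.nonneg_iff_isPositive _).1 (CFC.sqrt_nonneg P)
  have hux : ContinuousLinearEquiv.ofUnit u x = CFC.sqrt P x := by rw [← hu]; rfl
  have hsq : P x = CFC.sqrt P (CFC.sqrt P x) := by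
    conv_lhs => rw [← CFC.sqrt_mul_sqrt_self P hP0]
    rfl
  rw [hux, hsq, hsa.isSymmetric.apply_clm, ← inner_self_eq_norm_sq (𝕜 := ℂ)]
  rfl

/-- Powers of an expansive operator whose Gram sums grow linearly are uniformly bounded. -/
lemma norm_pow_sq_le_of_expansive_of_sum_le [CompleteSpace H] {T : H →L[ℂ] H} {C : ℝ} (hC : 0 ≤ C)
    (hmono : ∀ x, Monotone fun n ↦ ‖(T ^ n) x‖ ^ 2)
    (hO : ∀ n : ℕ,
      ‖∑ j ∈ Finset.range (n + 1), (adjoint (T ^ j)).comp (T ^ j)‖ ≤ C * (n + 1))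
    (n : ℕ) (x : H) : ‖(T ^ n) x‖ ^ 2 ≤ 2 * C * ‖x‖ ^ 2 := by
  set A := ∑ j ∈ Finset.range (2 * n + 1), (adjoint (T ^ j)).comp (T ^ j) with hA
  have hsum : (inner ℂ (A x) x).re = ∑ j ∈ Finset.range (2 * n + 1), ‖(T ^ j) x‖ ^ 2 := by
    simp only [hA, sum_apply, sum_inner, Complex.re_sum]
    refine Finset.sum_congr rfl fun j _ ↦ ?_
    rw [comp_apply, adjoint_inner_left]
    exact inner_self_eq_norm_sq (𝕜 := ℂ) _
  have hup : (inner ℂ (A x) x).re ≤ C * (2 * n + 1) * ‖x‖ ^ 2 := calc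
    (inner ℂ (A x) x).re ≤ ‖A x‖ * ‖x‖ := re_inner_le_norm (𝕜 := ℂ) _ _
    _ ≤ ‖A‖ * ‖x‖ * ‖x‖ := by gcongr; exact A.le_opNorm x
    _ ≤ C * (2 * n + 1) * ‖x‖ * ‖x‖ := by gcongr; exact_mod_cast hO (2 * n)
    _ = C * (2 * n + 1) * ‖x‖ ^ 2 := by ring
  have hlow : (n + 1) * ‖(T ^ n) x‖ ^ 2 ≤ ∑ j ∈ Finset.range (2 * n + 1), ‖(T ^ j) x‖ ^ 2 := by
    have hsub : Finset.Icc n (2 * n) ⊆ Finset.range (2 * n + 1) := fun j hj ↦ by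
      simp only [Finset.mem_Icc, Finset.mem_range] at hj ⊢; omega
    refine le_trans ?_ (Finset.sum_le_sum_of_subset_of_nonneg hsub fun _ _ _ ↦ by positivity)
    have hcard : (Finset.Icc n (2 * n)).card = n + 1 := by rw [Nat.card_Icc]; omega
    have := Finset.card_nsmul_le_sum (Finset.Icc n (2 * n)) (fun j ↦ ‖(T ^ j) x‖ ^ 2)
      (‖(T ^ n) x‖ ^ 2) fun j hj ↦ hmono x (Finset.mem_Icc.1 hj).1
    rw [hcard, nsmul_eq_mul] at this
    exact_mod_cast this
  have hn : (0 : ℝ) < n + 1 := by positivity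
  refine le_of_mul_le_mul_left ?_ hn
  have : 0 ≤ C * ‖x‖ ^ 2 := by positivity
  linarith

end

theorem similar_to_isometry_of_expansive_cesaro_O_n
    {H : Type*} [NormedAddCommGroup H] [InnerProductSpace ℂ H] [CompleteSpace H]
    (T : H →L[ℂ] H)
    (hexp : ∀ x : H, ‖x‖ ≤ ‖T x‖)
    (hO : ∃ C : ℝ, 0 < C ∧ ∀ n : ℕ,
      ‖∑ j ∈ Finset.range (n + 1), (adjoint (T ^ j)).comp (T ^ j)‖ ≤ C * (n + 1)) :
    ∃ L : H ≃L[ℂ] H, ∀ x : H, ‖L.symm (T (L x))‖ = ‖x‖ := by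
  obtain ⟨C, hC, hO⟩ := hO
  have hmono : ∀ x, Monotone fun n ↦ ‖(T ^ n) x‖ ^ 2 := fun x ↦
    monotone_nat_of_le_succ fun n ↦ by
      rw [pow_succ' T n]
      exact pow_le_pow_left₀ (norm_nonneg _) (hexp _) 2
  have hbound := norm_pow_sq_le_of_expansive_of_sum_le hC.le hmono hO
  have hlim : ∀ x, ∃ l : ℝ, Filter.Tendsto (fun n ↦ ‖(T ^ n) x‖ ^ 2) Filter.atTop (nhds l) :=
    fun x ↦ ⟨_, tendsto_atTop_ciSup (hmono x)
      ⟨2 * C * ‖x‖ ^ 2, Set.forall_mem_range.2 fun n ↦ hbound n x⟩⟩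
  have hM : ∀ n x, ‖(T ^ n) x‖ ≤ √(2 * C) * ‖x‖ := fun n x ↦ by
    refine abs_le_of_sq_le_sq' ?_ (by positivity) |>.2
    rw [mul_pow, Real.sq_sqrt (by positivity)]
    exact hbound n x
  obtain ⟨P, hP⟩ := exists_tendsto_inner_clm (fun n ↦ T ^ n) _ hM hlim
  have hPnorm : ∀ x, Filter.Tendsto (fun n ↦ ((‖(T ^ n) x‖ ^ 2 : ℝ) : ℂ)) Filter.atTop
      (nhds (inner ℂ (P x) x)) := fun x ↦ (hP x x).congr fun n ↦ by
    simp [inner_self_eq_norm_sq_to_K]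
  have hPre : ∀ x, Filter.Tendsto (fun n ↦ ‖(T ^ n) x‖ ^ 2) Filter.atTop
      (nhds (inner ℂ (P x) x).re) := fun x ↦
    (Complex.continuous_re.tendsto _).comp (hPnorm x)
  have hPreal : ∀ x, ((inner ℂ (P x) x).re : ℂ) = inner ℂ (P x) x := fun x ↦
    tendsto_nhds_unique ((Complex.continuous_ofReal.tendsto _).comp (hPre x)) (hPnorm x)
  have hPone : 1 ≤ P := by
    rw [ContinuousLinearMap.le_def, ContinuousLinearMap.isPositive_iff_complex]
    intro x
    have hge : ‖x‖ ^ 2 ≤ (inner ℂ (P x) x).re :=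
      ge_of_tendsto' (hPre x) fun n ↦ by simpa using hmono x (Nat.zero_le n)
    have hsub : inner ℂ ((P - 1) x) x = (((inner ℂ (P x) x).re - ‖x‖ ^ 2 : ℝ) : ℂ) := by
      rw [Complex.ofReal_sub, hPreal]
      simp [inner_self_eq_norm_sq_to_K]
    rw [hsub]
    exact ⟨rfl, sub_nonneg.2 hge⟩
  obtain ⟨L, hL⟩ := exists_equiv_norm_sq_eq_re_inner P hPone
  have hLT : ∀ x, ‖L (T x)‖ = ‖L x‖ := fun x ↦ by
    rw [← sq_eq_sq₀ (norm_nonneg _) (norm_nonneg _), hL, hL]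
    refine tendsto_nhds_unique (hPre (T x)) ?_
    refine ((hPre x).comp (Filter.tendsto_add_atTop_nat 1)).congr fun n ↦ ?_
    simp [pow_succ]
  exact ⟨L.symm, fun x ↦ by simp [hLT]⟩
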